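/- Let n ≥ 3 be an integer and δ > 0. There exists a constant C > 0 depending only on n and δ such that for every λ ∈ (0, 1] and every ξ ∈ ∂ℝⁿ₊ with |ξ| ≤ δ/2: ∫_{ℝⁿ₊ \ B_δ⁺} |∇U_{ξ,λ}(z)|² dz ≤ C λ^{n−2}, and consequently |∫_{B_δ⁺} |∇U_{ξ,λ}(z)|² dz − 1/(2^{2/n} S)| ≤ C λ^{n−2}. -/

import Mathlib

open MeasureTheory Real

/-- The sharp constant `S = (π n(n−2))⁻¹ (Γ(n)/Γ(n/2))^{2/n}` in the Sobolev
inequality on `ℝⁿ`. -/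
noncomputable def sobolevS (n : ℕ) : ℝ :=
  (π * n * ((n : ℝ) - 2))⁻¹ * (Real.Gamma n / Real.Gamma ((n : ℝ) / 2)) ^ ((2 : ℝ) / n)

/-- The constant `c(n) = 1/(2^{2/n}(n−2) n S)`. -/
noncomputable def bubbleC (n : ℕ) : ℝ :=
  1 / (2 ^ ((2 : ℝ) / n) * ((n : ℝ) - 2) * n * sobolevS n)

/-- The bubble `U_{x₀,λ}(x) = (λ/(λ² + c(n)|x−x₀|²))^{(n−2)/2}`. -/
noncomputable def bubble (n : ℕ) (x₀ : EuclideanSpace ℝ (Fin n)) (lam : ℝ)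
    (x : EuclideanSpace ℝ (Fin n)) : ℝ :=
  (lam / (lam ^ 2 + bubbleC n * ‖x - x₀‖ ^ 2)) ^ (((n : ℝ) - 2) / 2)

/-- The last coordinate `xₙ` of a point of `ℝⁿ`. -/
noncomputable def xlast (n : ℕ) (x : EuclideanSpace ℝ (Fin n)) : ℝ :=
  if h : n = 0 then 0 else x ⟨n - 1, by omega⟩

/-- The open upper half-space `ℝⁿ₊ = {x : xₙ > 0}`. -/
def upperHalf (n : ℕ) : Set (EuclideanSpace ℝ (Fin n)) := {x | 0 < xlast n x}



/-- The squared gradient norm of a centred bubble, as a function of the distance to the centre. -/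
noncomputable def bubbleEnergyDensity (n : ℕ) (lam r : ℝ) : ℝ :=
  ((n : ℝ) - 2) ^ 2 * bubbleC n ^ 2 * lam ^ (n - 2) *
    (r ^ 2 / (lam ^ 2 + bubbleC n * r ^ 2) ^ n)

lemma sobolevS_pos {n : ℕ} (hn : 3 ≤ n) : 0 < sobolevS n := by
  have h3 : (3 : ℝ) ≤ n := by exact_mod_cast hn
  have h2 : 0 < (n : ℝ) - 2 := by linarith
  have h0 : 0 < (n : ℝ) := by linarith
  have hG : 0 < Real.Gamma n := Real.Gamma_pos_of_pos h0
  have hG' : 0 < Real.Gamma ((n : ℝ) / 2) := Real.Gamma_pos_of_pos (by linarith)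
  unfold sobolevS
  positivity

lemma bubbleC_pos {n : ℕ} (hn : 3 ≤ n) : 0 < bubbleC n := by
  have h3 : (3 : ℝ) ≤ n := by exact_mod_cast hn
  have h2 : 0 < (n : ℝ) - 2 := by linarith
  have h0 : 0 < (n : ℝ) := by linarith
  have hS := sobolevS_pos hn
  unfold bubbleC
  positivity

lemma natCast_mul_bubbleC {n : ℕ} (hn : 3 ≤ n) :
    (n : ℝ) * ((n : ℝ) - 2) * bubbleC n = 1 / (2 ^ ((2 : ℝ) / n) * sobolevS n) := by
  have h3 : (3 : ℝ) ≤ n := by exact_mod_cast hn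
  have h2 : (n : ℝ) - 2 ≠ 0 := by linarith
  have h0 : (n : ℝ) ≠ 0 := by linarith
  have hS := (sobolevS_pos hn).ne'
  have h4 : (2 : ℝ) ^ ((2 : ℝ) / n) ≠ 0 := by positivity
  unfold bubbleC
  field_simp

lemma bubbleC_rpow_half {n : ℕ} (hn : 3 ≤ n) :
    bubbleC n ^ ((n : ℝ) / 2) =
      π ^ ((n : ℝ) / 2) * Real.Gamma ((n : ℝ) / 2) / (2 * Real.Gamma n) := by
  have h3 : (3 : ℝ) ≤ n := by exact_mod_cast hn
  have h2 : 0 < (n : ℝ) - 2 := by linarith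
  have h0 : 0 < (n : ℝ) := by linarith
  have hG : 0 < Real.Gamma n := Real.Gamma_pos_of_pos h0
  have hG' : 0 < Real.Gamma ((n : ℝ) / 2) := Real.Gamma_pos_of_pos (by linarith)
  have hpow : ∀ x : ℝ, 0 < x → (x ^ ((2 : ℝ) / n)) ^ ((n : ℝ) / 2) = x := fun x hx => by
    rw [← rpow_mul hx.le, show (2 : ℝ) / n * (n / 2) = 1 by field_simp, rpow_one]
  have h1 : bubbleC n = π / (2 ^ ((2 : ℝ) / n) *
      (Real.Gamma n / Real.Gamma ((n : ℝ) / 2)) ^ ((2 : ℝ) / n)) := by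
    unfold bubbleC sobolevS
    field_simp
  rw [h1, div_rpow (by positivity) (by positivity), mul_rpow (by positivity) (by positivity),
    hpow 2 (by norm_num), hpow _ (by positivity)]
  field_simp

lemma integral_Ioo_rpow_mul_one_sub_rpow {u v : ℝ} (hu : 0 < u) (hv : 0 < v) :
    ∫ x in Set.Ioo (0 : ℝ) 1, x ^ (u - 1) * (1 - x) ^ (v - 1) =
      Real.Gamma u * Real.Gamma v / Real.Gamma (u + v) := by
  change _ = ProbabilityTheory.beta u v
  rw [ProbabilityTheory.beta_eq_betaIntegralReal u v hu hv, Complex.betaIntegral,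
    intervalIntegral.integral_of_le zero_le_one, ← integral_Ioc_eq_integral_Ioo,
    ← Complex.ofReal_re (∫ x in Set.Ioc (0 : ℝ) 1, _), ← integral_complex_ofReal]
  congr 1
  refine setIntegral_congr_fun measurableSet_Ioc fun x hx => ?_
  rw [Complex.ofReal_mul, Complex.ofReal_cpow hx.1.le, Complex.ofReal_cpow (by linarith [hx.2])]
  push_cast
  rfl

/-- The Beta integral after the substitution `t = c r² / (a + c r²)`. -/
lemma integral_Ioi_rpow_mul_add_sq_rpow {a c u v : ℝ} (ha : 0 < a) (hc : 0 < c) (hu : 0 < u)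
    (hv : 0 < v) :
    ∫ r in Set.Ioi (0 : ℝ), r ^ (2 * u - 1) * (a + c * r ^ 2) ^ (-(u + v)) =
      Real.Gamma u * Real.Gamma v / (2 * c ^ u * a ^ v * Real.Gamma (u + v)) := by
  let f : ℝ → ℝ := fun r => c * r ^ 2 / (a + c * r ^ 2)
  have hD : ∀ r : ℝ, 0 < a + c * r ^ 2 := fun r => by positivity
  have hder : ∀ r ∈ Set.Ioi (0 : ℝ),
      HasDerivWithinAt f (2 * c * a * r / (a + c * r ^ 2) ^ 2) (Set.Ioi 0) r := fun r _ => by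
    have h1 : HasDerivAt (fun r : ℝ => c * r ^ 2) (c * (2 * r)) r := by
      simpa using (hasDerivAt_pow 2 r).const_mul c
    have h2 := h1.div (h1.const_add a) (hD r).ne'
    refine (h2.congr_deriv ?_).hasDerivWithinAt
    ring
  have hinj : Set.InjOn f (Set.Ioi 0) := fun x hx y hy hxy => by
    simp only [f] at hxy
    rw [div_eq_div_iff (hD x).ne' (hD y).ne'] at hxy
    have h : (c * a) * (x ^ 2) = (c * a) * (y ^ 2) := by linarith
    exact (sq_eq_sq₀ (le_of_lt hx) (le_of_lt hy)).1 (mul_left_cancel₀ (by positivity) h)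
  have himg : f '' Set.Ioi 0 = Set.Ioo 0 1 := by
    ext t
    constructor
    · rintro ⟨r, hr, rfl⟩
      have hr' : (0 : ℝ) < r := hr
      exact ⟨by simp only [f]; positivity, by simp only [f]; rw [div_lt_one (hD r)]; linarith⟩
    · rintro ⟨h0, h1⟩
      have h1' : 0 < 1 - t := by linarith
      have hpos : 0 < a * t / (c * (1 - t)) := by positivity
      refine ⟨√(a * t / (c * (1 - t))), Real.sqrt_pos.2 hpos, ?_⟩
      simp only [f]
      rw [Real.sq_sqrt hpos.le]
      field_simp
      ring
  have key := integral_image_eq_integral_abs_deriv_smul measurableSet_Ioi hder hinj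
    (fun t => t ^ (u - 1) * (1 - t) ^ (v - 1))
  rw [himg, integral_Ioo_rpow_mul_one_sub_rpow hu hv] at key
  have hcongr : ∀ r ∈ Set.Ioi (0 : ℝ),
      |2 * c * a * r / (a + c * r ^ 2) ^ 2| • (f r ^ (u - 1) * (1 - f r) ^ (v - 1)) =
      (2 * c ^ u * a ^ v) * (r ^ (2 * u - 1) * (a + c * r ^ 2) ^ (-(u + v))) := fun r hr => by
    have hr' : (0 : ℝ) < r := hr
    have hDr := hD r
    have e1 : 1 - f r = a / (a + c * r ^ 2) := by
      simp only [f]; field_simp; ring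
    rw [abs_of_pos (by positivity), e1, smul_eq_mul]
    simp only [f]
    generalize a + c * r ^ 2 = D at hDr
    rw [div_rpow (by positivity) hDr.le, div_rpow ha.le hDr.le,
      mul_rpow hc.le (by positivity), ← rpow_natCast r 2, ← rpow_mul hr'.le,
      rpow_sub_one hc.ne', rpow_sub_one ha.ne', rpow_sub_one hDr.ne', rpow_sub_one hDr.ne',
      rpow_neg hDr.le, rpow_add hDr, rpow_sub_one hr'.ne',
      show ((2 : ℕ) : ℝ) * (u - 1) = 2 * u - 2 by push_cast; ring, rpow_sub hr', rpow_two]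
    field_simp
  rw [setIntegral_congr_fun measurableSet_Ioi hcongr, integral_const_mul] at key
  have hK : 2 * c ^ u * a ^ v ≠ 0 := by positivity
  have hG : Real.Gamma (u + v) ≠ 0 := (Real.Gamma_pos_of_pos (by positivity)).ne'
  field_simp at key ⊢
  linarith

lemma norm_gradient_bubble_sq {n : ℕ} (hn : 3 ≤ n) (ξ z : EuclideanSpace ℝ (Fin n)) {lam : ℝ}
    (hlam : 0 < lam) :
    ‖gradient (bubble n ξ lam) z‖ ^ 2 = bubbleEnergyDensity n lam ‖z - ξ‖ := by
  have hc := bubbleC_pos hn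
  set r := ‖z - ξ‖ with hr
  set c := bubbleC n with hcdef
  have hD : 0 < lam ^ 2 + c * r ^ 2 := by positivity
  have h1 : HasFDerivAt (fun x : EuclideanSpace ℝ (Fin n) => ‖x - ξ‖ ^ 2)
      (2 • innerSL ℝ (z - ξ)) z := by
    have := ((hasFDerivAt_id z).sub_const ξ).norm_sq
    convert! this using 1
  have h2 : HasDerivAt (fun t : ℝ => lam ^ 2 + c * t) c (r ^ 2) := by
    simpa using ((hasDerivAt_id (r ^ 2)).const_mul c).const_add (lam ^ 2)
  have h3 := ((hasDerivAt_const (r ^ 2) lam).div h2 hD.ne').rpow_const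
    (p := ((n : ℝ) - 2) / 2) (Or.inl (div_pos hlam hD).ne')
  have h4 := HasDerivAt.comp_hasFDerivAt z h3 h1
  have h5 : fderiv ℝ (bubble n ξ lam) z = _ := h4.fderiv
  rw [gradient, LinearIsometryEquiv.norm_map, h5, norm_smul, mul_pow, ← Nat.cast_smul_eq_nsmul ℝ,
    norm_smul, innerSL_apply_norm, ← hr, bubbleEnergyDensity, ← hcdef]
  simp only [Real.norm_eq_abs, sq_abs, mul_pow, Pi.div_apply]
  generalize lam ^ 2 + c * r ^ 2 = D at hD
  have hq : 0 < lam / D := div_pos hlam hD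
  have e : ((lam / D) ^ (((n : ℝ) - 2) / 2 - 1)) ^ 2 =
      lam ^ (n - 2) / D ^ n * (D ^ 4 / lam ^ 2) := by
    obtain ⟨m, rfl⟩ : ∃ m, n = m + 2 := ⟨n - 2, by omega⟩
    rw [← rpow_natCast, ← rpow_mul hq.le,
      show ((((m + 2 : ℕ) : ℝ) - 2) / 2 - 1) * ((2 : ℕ) : ℝ) = (m : ℝ) - (2 : ℕ) by push_cast; ring,
      rpow_sub_natCast hq.ne', rpow_natCast, Nat.add_sub_cancel, div_pow]
    field_simp
    ring
  rw [e, zero_mul, zero_sub, Nat.cast_ofNat]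
  field_simp

lemma bubbleEnergyDensity_nonneg {n : ℕ} (hn : 3 ≤ n) (lam r : ℝ) (hlam : 0 < lam) :
    0 ≤ bubbleEnergyDensity n lam r := by
  have hc := bubbleC_pos hn
  unfold bubbleEnergyDensity
  positivity

lemma bubbleEnergyDensity_le {n : ℕ} (hn : 3 ≤ n) {lam r k : ℝ} (hlam : 0 < lam) (hk : 0 < k)
    (hr : k * (1 + r ^ 2) ≤ lam ^ 2 + bubbleC n * r ^ 2) :
    bubbleEnergyDensity n lam r ≤ lam ^ (n - 2) * (((n : ℝ) - 2) ^ 2 * bubbleC n ^ 2 / k ^ n *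
      (1 + r ^ 2) ^ (-(2 * (n : ℝ) - 2) / 2)) := by
  have hc := bubbleC_pos hn
  have h1 : 0 < 1 + r ^ 2 := by positivity
  have e : (1 + r ^ 2) ^ (-(2 * (n : ℝ) - 2) / 2) = (1 + r ^ 2) / (1 + r ^ 2) ^ n := by
    rw [show -(2 * (n : ℝ) - 2) / 2 = 1 - n by ring, rpow_sub h1, rpow_one, rpow_natCast]
  have h2 : r ^ 2 / (lam ^ 2 + bubbleC n * r ^ 2) ^ n ≤ (1 + r ^ 2) / (k * (1 + r ^ 2)) ^ n := by
    gcongr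
    linarith
  calc bubbleEnergyDensity n lam r
      ≤ ((n : ℝ) - 2) ^ 2 * bubbleC n ^ 2 * lam ^ (n - 2) *
        ((1 + r ^ 2) / (k * (1 + r ^ 2)) ^ n) := by
        unfold bubbleEnergyDensity; gcongr
    _ = _ := by rw [e, mul_pow]; field_simp

lemma integrable_one_add_norm_sq_rpow {n : ℕ} (hn : 3 ≤ n) :
    Integrable fun w : EuclideanSpace ℝ (Fin n) =>
      (1 + ‖w‖ ^ 2) ^ (-(2 * (n : ℝ) - 2) / 2) := by
  have h3 : (3 : ℝ) ≤ n := by exact_mod_cast hn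
  refine integrable_rpow_neg_one_add_norm_sq ?_
  rw [finrank_euclideanSpace_fin]
  linarith

lemma integrable_bubbleEnergyDensity {n : ℕ} (hn : 3 ≤ n) {lam : ℝ} (hlam : 0 < lam) :
    Integrable fun w : EuclideanSpace ℝ (Fin n) => bubbleEnergyDensity n lam ‖w‖ := by
  have hc := bubbleC_pos hn
  refine (((integrable_one_add_norm_sq_rpow hn).const_mul (((n : ℝ) - 2) ^ 2 * bubbleC n ^ 2 /
    (min (lam ^ 2) (bubbleC n)) ^ n)).const_mul (lam ^ (n - 2))).mono' ?_
    (Filter.Eventually.of_forall fun w => ?_)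
  · unfold bubbleEnergyDensity
    exact Measurable.aestronglyMeasurable (by fun_prop)
  · rw [Real.norm_of_nonneg (bubbleEnergyDensity_nonneg hn _ _ hlam)]
    refine bubbleEnergyDensity_le hn hlam (lt_min (by positivity) hc) ?_
    rw [mul_add, mul_one]
    gcongr
    · exact min_le_left _ _
    · exact min_le_right _ _

lemma integral_bubbleEnergyDensity {n : ℕ} (hn : 3 ≤ n) {lam : ℝ} (hlam : 0 < lam) :
    ∫ w : EuclideanSpace ℝ (Fin n), bubbleEnergyDensity n lam ‖w‖ =
      2 * (1 / (2 ^ ((2 : ℝ) / n) * sobolevS n)) := by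
  have hc := bubbleC_pos hn
  have h3 : (3 : ℝ) ≤ n := by exact_mod_cast hn
  have h2 : 0 < (n : ℝ) - 2 := by linarith
  have h0 : 0 < (n : ℝ) := by linarith
  have : Nonempty (Fin n) := ⟨⟨0, by omega⟩⟩
  have hball : volume.real (Metric.ball (0 : EuclideanSpace ℝ (Fin n)) 1) =
      π ^ ((n : ℝ) / 2) / Real.Gamma ((n : ℝ) / 2 + 1) := by
    have : 0 ≤ √π ^ n / Real.Gamma ((n : ℝ) / 2 + 1) :=
      div_nonneg (by positivity) (Real.Gamma_pos_of_pos (by positivity)).le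
    rw [Measure.real, EuclideanSpace.volume_ball]
    simp only [Fintype.card_fin, ENNReal.ofReal_one, one_pow, one_mul]
    rw [ENNReal.toReal_ofReal this, Real.sqrt_eq_rpow, ← rpow_natCast, ← rpow_mul pi_pos.le]
    congr 2
    ring
  have hrad : ∀ r ∈ Set.Ioi (0 : ℝ), r ^ (n - 1) • bubbleEnergyDensity n lam r =
      (((n : ℝ) - 2) ^ 2 * bubbleC n ^ 2 * lam ^ (n - 2)) *
      (r ^ (2 * ((n : ℝ) / 2 + 1) - 1) *
        (lam ^ 2 + bubbleC n * r ^ 2) ^ (-(((n : ℝ) / 2 + 1) + ((n : ℝ) / 2 - 1)))) := by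
    intro r hr
    have hr' : (0 : ℝ) < r := hr
    have hD : 0 < lam ^ 2 + bubbleC n * r ^ 2 := by positivity
    rw [show -(((n : ℝ) / 2 + 1) + ((n : ℝ) / 2 - 1)) = -(n : ℝ) by ring, rpow_neg hD.le,
      rpow_natCast, show 2 * ((n : ℝ) / 2 + 1) - 1 = ((n - 1 + 2 : ℕ) : ℝ) by
        rw [show n - 1 + 2 = n + 1 by omega]; push_cast; ring, rpow_natCast, pow_add,
      bubbleEnergyDensity, smul_eq_mul]
    field_simp
  rw [integral_fun_norm_addHaar volume (bubbleEnergyDensity n lam), finrank_euclideanSpace_fin,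
    setIntegral_congr_fun measurableSet_Ioi hrad, integral_const_mul,
    integral_Ioi_rpow_mul_add_sq_rpow (by positivity) hc (by positivity) (by linarith), hball,
    ← natCast_mul_bubbleC hn]
  have hhalf := bubbleC_rpow_half hn
  have hG : 0 < Real.Gamma n := Real.Gamma_pos_of_pos h0
  have hG1 : 0 < Real.Gamma ((n : ℝ) / 2 - 1) := Real.Gamma_pos_of_pos (by linarith)
  have hG2 : 0 < Real.Gamma ((n : ℝ) / 2 + 1) := Real.Gamma_pos_of_pos (by linarith)
  have hrec : Real.Gamma ((n : ℝ) / 2) = ((n : ℝ) / 2 - 1) * Real.Gamma ((n : ℝ) / 2 - 1) := by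
    rw [← Real.Gamma_add_one (by linarith), sub_add_cancel]
  have hl : (lam ^ 2) ^ ((n : ℝ) / 2 - 1) = lam ^ (n - 2) := by
    rw [← rpow_natCast lam 2, ← rpow_mul hlam.le, ← rpow_natCast]
    congr 1
    rw [Nat.cast_sub (by omega)]
    push_cast
    ring
  rw [hl, rpow_add_one hc.ne', hhalf, hrec, show (n : ℝ) / 2 + 1 + (n / 2 - 1) = n by ring]
  simp only [nsmul_eq_mul, smul_eq_mul]
  have hpi : 0 < π ^ ((n : ℝ) / 2) := by positivity
  have h22 : (n : ℝ) / 2 - 1 = (n - 2) / 2 := by ring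
  rw [h22] at hG1 ⊢
  generalize Real.Gamma (((n : ℝ) - 2) / 2) = G1 at *
  generalize (n : ℝ) - 2 = m at *
  field_simp

lemma xlast_eq {n : ℕ} (hn : 3 ≤ n) (x : EuclideanSpace ℝ (Fin n)) :
    xlast n x = x ⟨n - 1, by omega⟩ := by
  rw [xlast, dif_neg (by omega)]

lemma measurableSet_upperHalf {n : ℕ} (hn : 3 ≤ n) : MeasurableSet (upperHalf n) := by
  unfold upperHalf
  simp only [xlast_eq hn]
  exact measurableSet_lt measurable_const (by fun_prop)

lemma volume_xlast_eq_zero {n : ℕ} (hn : 3 ≤ n) :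
    volume {x : EuclideanSpace ℝ (Fin n) | xlast n x = 0} = 0 := by
  let i : Fin n := ⟨n - 1, by omega⟩
  have h := Measure.addHaar_submodule (volume : Measure (EuclideanSpace ℝ (Fin n)))
    (LinearMap.ker (EuclideanSpace.proj i : EuclideanSpace ℝ (Fin n) →L[ℝ] ℝ).toLinearMap)
    (fun htop => by
      have : EuclideanSpace.single i (1 : ℝ) ∈
        LinearMap.ker (EuclideanSpace.proj i : EuclideanSpace ℝ (Fin n) →L[ℝ] ℝ).toLinearMap := by
        rw [htop]; trivial
      simp at this)
  refine measure_mono_null (fun x hx => ?_) h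
  have hx' : xlast n x = 0 := hx
  rw [xlast_eq hn] at hx'
  simpa using hx'

lemma setIntegral_upperHalf_norm_sub {n : ℕ} (hn : 3 ≤ n) {g : ℝ → ℝ}
    (hg : Integrable fun w : EuclideanSpace ℝ (Fin n) => g ‖w‖) {ξ : EuclideanSpace ℝ (Fin n)}
    (hξ : xlast n ξ = 0) :
    ∫ z in upperHalf n, g ‖z - ξ‖ = (∫ w : EuclideanSpace ℝ (Fin n), g ‖w‖) / 2 := by
  have htrans : ∫ z in upperHalf n, g ‖z - ξ‖ = ∫ w in upperHalf n, g ‖w‖ := by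
    have h := (measurePreserving_sub_right volume ξ).setIntegral_preimage_emb
      (MeasurableEquiv.subRight ξ).measurableEmbedding (fun w => g ‖w‖) (upperHalf n)
    rw [← h]
    congr 2
    ext z
    rw [xlast_eq hn] at hξ
    simp [upperHalf, xlast_eq hn, hξ]
  have hneg : ∫ w in (upperHalf n)ᶜ, g ‖w‖ = ∫ w in upperHalf n, g ‖w‖ := by
    have h := (Measure.measurePreserving_neg
      (volume : Measure (EuclideanSpace ℝ (Fin n)))).setIntegral_preimage_emb
      (MeasurableEquiv.neg _).measurableEmbedding (fun w => g ‖w‖) (upperHalf n)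
    simp only [norm_neg] at h
    rw [← h]
    refine setIntegral_congr_set ?_
    have hae : ∀ᵐ x : EuclideanSpace ℝ (Fin n), xlast n x ≠ 0 :=
      measure_eq_zero_iff_ae_notMem.1 (volume_xlast_eq_zero hn)
    filter_upwards [hae] with x hx
    rw [xlast_eq hn] at hx
    refine propext ?_
    change ¬ (0 < xlast n x) ↔ 0 < xlast n (-x)
    simp only [xlast_eq hn, PiLp.neg_apply, not_lt, Left.neg_pos_iff]
    exact ⟨fun h => lt_of_le_of_ne h hx, le_of_lt⟩
  have hsum := integral_add_compl (measurableSet_upperHalf hn) hg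
  rw [htrans]
  linarith

/-- for `λ ∈ (0,1]` and boundary points `ξ` with `|ξ| ≤ δ/2`,
the Dirichlet energy of `U_{ξ,λ}` outside `B_δ⁺` is `O(λ^{n−2})`, and hence the
energy in `B_δ⁺` equals `1/(2^{2/n}S)` up to `O(λ^{n−2})`. -/
theorem energy_outside_ball (n : ℕ) (hn : 3 ≤ n) (δ : ℝ) (hδ : 0 < δ) :
    ∃ C > (0 : ℝ), ∀ lam : ℝ, 0 < lam → lam ≤ 1 →
      ∀ ξ : EuclideanSpace ℝ (Fin n), xlast n ξ = 0 → ‖ξ‖ ≤ δ / 2 →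
      (∫ z in upperHalf n \ Metric.ball 0 δ, ‖gradient (bubble n ξ lam) z‖ ^ 2) ≤
          C * lam ^ ((n : ℝ) - 2) ∧
        |(∫ z in Metric.ball 0 δ ∩ upperHalf n, ‖gradient (bubble n ξ lam) z‖ ^ 2) -
            1 / (2 ^ ((2 : ℝ) / n) * sobolevS n)| ≤ C * lam ^ ((n : ℝ) - 2) := by
  have hc := bubbleC_pos hn
  set k : ℝ := bubbleC n * ((δ / 2) ^ 2 / (1 + (δ / 2) ^ 2)) with hk
  have hkpos : 0 < k := by positivity
  let H : EuclideanSpace ℝ (Fin n) → ℝ := fun w =>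
    ((n : ℝ) - 2) ^ 2 * bubbleC n ^ 2 / k ^ n * (1 + ‖w‖ ^ 2) ^ (-(2 * (n : ℝ) - 2) / 2)
  have hHint : Integrable H := (integrable_one_add_norm_sq_rpow hn).const_mul _
  have hH0 : ∀ w, 0 ≤ H w := fun w => by simp only [H]; positivity
  have hHI : 0 ≤ ∫ w, H w := integral_nonneg hH0
  refine ⟨(∫ w, H w) + 1, by linarith, fun lam hlam _ ξ hξ hξδ => ?_⟩
  have hpow : lam ^ ((n : ℝ) - 2) = lam ^ (n - 2) := by
    rw [← rpow_natCast, Nat.cast_sub (by omega)]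
    norm_num
  simp only [norm_gradient_bubble_sq hn ξ _ hlam, hpow]
  have hint : Integrable fun z => bubbleEnergyDensity n lam ‖z - ξ‖ :=
    (integrable_bubbleEnergyDensity hn hlam).comp_sub_right ξ
  have hHint' : Integrable fun z => lam ^ (n - 2) * H (z - ξ) :=
    (hHint.comp_sub_right ξ).const_mul _
  have hmeas := measurableSet_upperHalf hn
  have hout : ∫ z in upperHalf n \ Metric.ball 0 δ, bubbleEnergyDensity n lam ‖z - ξ‖ ≤
      ((∫ w, H w) + 1) * lam ^ (n - 2) := calc
    _ ≤ ∫ z in upperHalf n \ Metric.ball 0 δ, lam ^ (n - 2) * H (z - ξ) := by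
      refine setIntegral_mono_on hint.integrableOn hHint'.integrableOn
        (hmeas.diff measurableSet_ball) fun z hz => ?_
      refine bubbleEnergyDensity_le hn hlam hkpos ?_
      have hzδ : δ ≤ ‖z‖ := by simpa using hz.2
      have hr : δ / 2 ≤ ‖z - ξ‖ := by linarith [norm_sub_norm_le z ξ]
      have hr2 : (δ / 2) ^ 2 ≤ ‖z - ξ‖ ^ 2 := by gcongr
      have : (δ / 2) ^ 2 / (1 + (δ / 2) ^ 2) * (1 + ‖z - ξ‖ ^ 2) ≤ ‖z - ξ‖ ^ 2 := by
        rw [div_mul_eq_mul_div, div_le_iff₀ (by positivity)]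
        linarith
      rw [hk, mul_assoc]
      have := mul_le_mul_of_nonneg_left this hc.le
      linarith [sq_nonneg lam]
    _ ≤ ∫ z, lam ^ (n - 2) * H (z - ξ) :=
      setIntegral_le_integral hHint' (Filter.Eventually.of_forall fun z =>
        mul_nonneg (by positivity) (hH0 _))
    _ = lam ^ (n - 2) * ∫ w, H w := by
      rw [integral_const_mul, integral_sub_right_eq_self H ξ]
    _ ≤ _ := by
      rw [mul_comm]
      gcongr
      linarith
  refine ⟨hout, ?_⟩
  have hsplit := integral_inter_add_sdiff (μ := volume) (s := upperHalf n)
    (t := Metric.ball 0 δ) measurableSet_ball hint.integrableOn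
  rw [setIntegral_upperHalf_norm_sub hn (integrable_bubbleEnergyDensity hn hlam) hξ,
    integral_bubbleEnergyDensity hn hlam, Set.inter_comm] at hsplit
  have hout0 : 0 ≤ ∫ z in upperHalf n \ Metric.ball 0 δ, bubbleEnergyDensity n lam ‖z - ξ‖ :=
    integral_nonneg fun z => bubbleEnergyDensity_nonneg hn _ _ hlam
  rw [abs_le]
  constructor <;> linarith
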